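/- arXiv:2412.15999 — 4 statements merged into one kernel-verified Lean document; each statement's English description precedes it below -/
import Mathlib

section
/- Let T ≥ 0, let ρ be a Borel probability measure on [0,∞) with ρ({0}) = 0, and let K, Q be bounded Borel functions on [0,T] with Q ≥ 0 pointwise. If K(t) ≥ ∫_{[0,t]} Q(t−s)K(t−s) ρ(ds) for every t ∈ [0,T], then K(t) ≥ 0 for every t ∈ [0,T]. -/
open MeasureTheory

/-- The convolution of a function with a measure:
`(g * ρ)(t) = ∫_{[0,t]} g(t-s) ρ(ds)`. -/
noncomputable def mconv (g : ℝ → ℝ) (ρ : Measure ℝ) (t : ℝ) : ℝ :=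
  ∫ s in Set.Icc 0 t, g (t - s) ∂ρ

open Filter Topology

/-- The Laplace transform of a finite measure without an atom at `0` tends to `0` at infinity. -/
lemma tendsto_setIntegral_Ici_exp_neg_mul (ρ : Measure ℝ) [IsFiniteMeasure ρ]
    (hρ0 : ρ {0} = 0) :
    Tendsto (fun n : ℕ => ∫ s in Set.Ici 0, Real.exp (-(n * s)) ∂ρ) atTop (𝓝 0) := by
  have hne : ∀ᵐ s ∂(ρ.restrict (Set.Ici 0)), s ≠ 0 :=
    ae_restrict_of_ae (measure_eq_zero_iff_ae_notMem.1 hρ0)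
  have hmem : ∀ᵐ s ∂(ρ.restrict (Set.Ici 0)), s ∈ Set.Ici (0 : ℝ) :=
    ae_restrict_mem measurableSet_Ici
  suffices h : Tendsto (fun n : ℕ => ∫ s in Set.Ici 0, Real.exp (-(n * s)) ∂ρ) atTop
      (𝓝 (∫ _ in Set.Ici (0 : ℝ), (0 : ℝ) ∂ρ)) by simpa only [integral_zero] using h
  refine tendsto_integral_of_dominated_convergence (fun _ => 1) (fun n => ?_)
    (integrable_const _) (fun n => ?_) ?_
  · exact (by fun_prop : Continuous fun s : ℝ => Real.exp (-(n * s))).aestronglyMeasurable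
  · filter_upwards [hmem] with s hs
    have hs : 0 ≤ s := hs
    rw [Real.norm_eq_abs, Real.abs_exp, Real.exp_le_one_iff]
    have : 0 ≤ (n : ℝ) * s := by positivity
    linarith
  · filter_upwards [hmem, hne] with s hs hs0
    exact Real.tendsto_exp_neg_atTop_nhds_zero.comp
      (tendsto_natCast_atTop_atTop.atTop_mul_const (lt_of_le_of_ne hs hs0.symm))

/-- An exponentially weighted lower bound on `K` gives one on the convolution `(Q K) * ρ`. -/
lemma neg_mul_exp_le_mconv {ρ : Measure ℝ} [IsFiniteMeasure ρ] {K Q : ℝ → ℝ}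
    (hKmeas : Measurable K) (hQmeas : Measurable Q) {T t a r C M : ℝ} (ht : t ∈ Set.Icc 0 T)
    (ha : 0 ≤ a) (hr : 0 ≤ r)
    (hK : ∀ u ∈ Set.Icc 0 T, |K u| ≤ M) (hQ : ∀ u ∈ Set.Icc 0 T, |Q u| ≤ C)
    (hQpos : ∀ u ∈ Set.Icc 0 T, 0 ≤ Q u)
    (hlow : ∀ u ∈ Set.Icc 0 T, -(a * Real.exp (r * u)) ≤ K u) :
    -(a * Real.exp (r * t) * (C * ∫ s in Set.Ici 0, Real.exp (-(r * s)) ∂ρ)) ≤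
      mconv (fun u => Q u * K u) ρ t := by
  have hsub : ∀ s ∈ Set.Icc 0 t, t - s ∈ Set.Icc 0 T := fun s hs =>
    ⟨by linarith [hs.2], by linarith [hs.1, ht.2]⟩
  have hC : 0 ≤ C := (abs_nonneg _).trans (hQ t ht)
  have hexp : IntegrableOn (fun s => Real.exp (-(r * s))) (Set.Ici 0) ρ := by
    refine Measure.integrableOn_of_bounded (M := 1) (measure_ne_top _ _)
      (by fun_prop : Continuous fun s : ℝ => Real.exp (-(r * s))).aestronglyMeasurable ?_
    filter_upwards [ae_restrict_mem measurableSet_Ici] with s hs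
    rw [Real.norm_eq_abs, Real.abs_exp, Real.exp_le_one_iff]
    linarith [mul_nonneg hr hs]
  have hQK : IntegrableOn (fun s => Q (t - s) * K (t - s)) (Set.Icc 0 t) ρ := by
    refine Measure.integrableOn_of_bounded (M := C * M) (measure_ne_top _ _)
      (by fun_prop : Measurable fun s => Q (t - s) * K (t - s)).aestronglyMeasurable ?_
    filter_upwards [ae_restrict_mem measurableSet_Icc] with s hs
    rw [norm_mul]
    exact mul_le_mul (hQ _ (hsub s hs)) (hK _ (hsub s hs)) (abs_nonneg _) hC
  have hsubset : Set.Icc 0 t ⊆ Set.Ici (0 : ℝ) := Set.Icc_subset_Ici_self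
  have hmono : ∫ s in Set.Icc 0 t, Real.exp (-(r * s)) ∂ρ ≤
      ∫ s in Set.Ici 0, Real.exp (-(r * s)) ∂ρ :=
    setIntegral_mono_set hexp (ae_of_all _ fun s => (Real.exp_pos _).le) hsubset.eventuallyLE
  calc -(a * Real.exp (r * t) * (C * ∫ s in Set.Ici 0, Real.exp (-(r * s)) ∂ρ))
      ≤ -(a * Real.exp (r * t) * (C * ∫ s in Set.Icc 0 t, Real.exp (-(r * s)) ∂ρ)) := by
        gcongr
    _ = ∫ s in Set.Icc 0 t, -(a * Real.exp (r * t) * C) * Real.exp (-(r * s)) ∂ρ := by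
        rw [integral_const_mul]; ring
    _ ≤ mconv (fun u => Q u * K u) ρ t := by
        refine setIntegral_mono_on ((hexp.mono_set hsubset).const_mul _) hQK
          measurableSet_Icc fun s hs => ?_
        have hu := hsub s hs
        have hsplit : Real.exp (r * (t - s)) = Real.exp (r * t) * Real.exp (-(r * s)) := by
          rw [← Real.exp_add]; ring_nf
        calc -(a * Real.exp (r * t) * C) * Real.exp (-(r * s))
            = -(C * (a * Real.exp (r * (t - s)))) := by rw [hsplit]; ring
          _ ≤ -(Q (t - s) * (a * Real.exp (r * (t - s)))) := by
              gcongr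
              exact (le_abs_self _).trans (hQ _ hu)
          _ = Q (t - s) * -(a * Real.exp (r * (t - s))) := by ring
          _ ≤ Q (t - s) * K (t - s) := mul_le_mul_of_nonneg_left (hlow _ hu) (hQpos _ hu)

/-- Positivity lemma: if `ρ` is a probability measure on `[0,∞)`
with `ρ({0}) = 0`, `K, Q` are bounded Borel functions on `[0,T]` with `Q ≥ 0`,
and `K ≥ (QK)*ρ` on `[0,T]`, then `K ≥ 0` on `[0,T]`. -/
theorem stmt_6 (T : ℝ) (hT : 0 ≤ T)
    (ρ : Measure ℝ) [IsProbabilityMeasure ρ]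
    (hρ0 : ρ {0} = 0) (hρpos : ρ (Set.Iio 0) = 0)
    (K Q : ℝ → ℝ) (hKmeas : Measurable K) (hQmeas : Measurable Q)
    (hKbdd : ∃ M : ℝ, ∀ t ∈ Set.Icc 0 T, |K t| ≤ M)
    (hQbdd : ∃ M : ℝ, ∀ t ∈ Set.Icc 0 T, |Q t| ≤ M)
    (hQpos : ∀ t ∈ Set.Icc 0 T, 0 ≤ Q t)
    (hineq : ∀ t ∈ Set.Icc 0 T, mconv (fun u => Q u * K u) ρ t ≤ K t) :
    ∀ t ∈ Set.Icc 0 T, 0 ≤ K t := by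
  obtain ⟨M, hM⟩ := hKbdd
  obtain ⟨C, hC⟩ := hQbdd
  have hM0 : 0 ≤ M := (abs_nonneg _).trans (hM 0 ⟨le_rfl, hT⟩)
  have hlim := (tendsto_setIntegral_Ici_exp_neg_mul ρ hρ0).const_mul C
  rw [mul_zero] at hlim
  obtain ⟨n, hn⟩ := (hlim.eventually_le_const (by norm_num : (0 : ℝ) < 1 / 2)).exists
  have hlow : ∀ m : ℕ, ∀ t ∈ Set.Icc 0 T, -(M * (1 / 2) ^ m * Real.exp (n * t)) ≤ K t := by
    intro m
    induction m with
    | zero =>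
      intro t ht
      have hexp : 1 ≤ Real.exp (n * t) := Real.one_le_exp (mul_nonneg n.cast_nonneg ht.1)
      have hbound := neg_le_of_abs_le (hM t ht)
      rw [pow_zero, mul_one]
      linarith [le_mul_of_one_le_right hM0 hexp]
    | succ m ih =>
      intro t ht
      calc -(M * (1 / 2) ^ (m + 1) * Real.exp (n * t))
          = -(M * (1 / 2) ^ m * Real.exp (n * t) * (1 / 2)) := by ring
        _ ≤ -(M * (1 / 2) ^ m * Real.exp (n * t) *
              (C * ∫ s in Set.Ici 0, Real.exp (-(n * s)) ∂ρ)) := by gcongr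
        _ ≤ mconv (fun u => Q u * K u) ρ t :=
            neg_mul_exp_le_mconv hKmeas hQmeas ht (by positivity) n.cast_nonneg hM hC hQpos ih
        _ ≤ K t := hineq t ht
  intro t ht
  have hpow : Tendsto (fun m : ℕ => -(M * (1 / 2 : ℝ) ^ m * Real.exp (n * t))) atTop (𝓝 0) := by
    simpa using (((tendsto_pow_atTop_nhds_zero_of_lt_one (by norm_num : (0 : ℝ) ≤ 1 / 2)
      (by norm_num)).const_mul M).mul_const (Real.exp (n * t))).neg
  exact le_of_tendsto' hpow fun m => hlow m t ht
end

section
/- Let T ≥ 0, let ρ be a Borel probability measure on [0,∞) with ρ({0}) = 0, and let F be a bounded Borel function on [0,T] with |F(t)| ≤ 1/2 for all t. If the bounded Borel function K satisfies K = F + ½(K²)*ρ on [0,T], then for every t ∈ [0,T]: −sup_{u∈[0,t]}|F(u)| ≤ K(t) ≤ 1 − √(1 − 2 sup_{u∈[0,t]}|F(u)|). -/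
open MeasureTheory

/-- The Laplace transform of a finite measure on `(0,∞)` vanishes at infinity. -/
theorem tendsto_integral_exp_neg_nat_mul (ρ : Measure ℝ) [IsFiniteMeasure ρ]
    (hpos : ∀ᵐ s ∂ρ, 0 < s) :
    Filter.Tendsto (fun n : ℕ => ∫ s, Real.exp (-(n * s)) ∂ρ) Filter.atTop (nhds 0) := by
  have h := tendsto_integral_of_dominated_convergence (μ := ρ)
    (F := fun (n : ℕ) s => Real.exp (-(n * s))) (f := fun _ => 0) (fun _ => (1 : ℝ))
    (fun n => by fun_prop) (integrable_const _)
    (fun n => by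
      filter_upwards [hpos] with s hs
      rw [Real.norm_eq_abs, Real.abs_exp, Real.exp_le_one_iff]
      have : (0 : ℝ) ≤ n * s := by positivity
      linarith)
    (by
      filter_upwards [hpos] with s hs
      refine Real.tendsto_exp_neg_atTop_nhds_zero.comp ?_
      exact tendsto_natCast_atTop_atTop.atTop_mul_const hs)
  simpa using h

theorem mconv_nonneg {g : ℝ → ℝ} (hg : ∀ u, 0 ≤ g u) (ρ : Measure ℝ) (t : ℝ) :
    0 ≤ mconv g ρ t :=
  integral_nonneg fun s => hg (t - s)

/-- If `g ≤ a + c e^{λ ·}` on `[0,u]`, then `(g * ρ)(u) ≤ a + c e^{λ u} ∫ e^{-λ s} ρ(ds)`. -/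
theorem mconv_le_of_le_const_add_exp (ρ : Measure ℝ) [IsProbabilityMeasure ρ]
    {g : ℝ → ℝ} (hg0 : ∀ u, 0 ≤ g u) {a c l u : ℝ} (ha : 0 ≤ a) (hc : 0 ≤ c)
    (hint : Integrable (fun s => Real.exp (-(l * s))) ρ)
    (hg : ∀ v ∈ Set.Icc 0 u, g v ≤ a + c * Real.exp (l * v)) :
    mconv g ρ u ≤ a + c * Real.exp (l * u) * ∫ s, Real.exp (-(l * s)) ∂ρ := by
  have hint' : Integrable (fun s => a + c * Real.exp (l * u) * Real.exp (-(l * s))) ρ :=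
    (integrable_const a).add (hint.const_mul _)
  calc mconv g ρ u
      ≤ ∫ s in Set.Icc 0 u, (a + c * Real.exp (l * u) * Real.exp (-(l * s))) ∂ρ := by
        refine integral_mono_of_nonneg (Filter.Eventually.of_forall fun s => hg0 (u - s))
          hint'.integrableOn ?_
        filter_upwards [ae_restrict_mem measurableSet_Icc] with s hs
        refine (hg (u - s) ⟨by linarith [hs.2], by linarith [hs.1]⟩).trans_eq ?_
        rw [mul_assoc, ← Real.exp_add]
        ring_nf
    _ ≤ ∫ s, (a + c * Real.exp (l * u) * Real.exp (-(l * s))) ∂ρ :=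
        setIntegral_le_integral hint' (Filter.Eventually.of_forall fun s => by
          simp only [Pi.zero_apply]; positivity)
    _ = a + c * Real.exp (l * u) * ∫ s, Real.exp (-(l * s)) ∂ρ := by
        rw [integral_add (integrable_const a) (hint.const_mul _), integral_const_mul]
        simp

/-- A bounded solution of the convolutional Riccati equation on `[0,t]` with `|F| ≤ M` stays
below any nonnegative `r` with `r = M + r² / 2`. -/
theorem abs_le_of_riccati (ρ : Measure ℝ) [IsProbabilityMeasure ρ] (hpos : ∀ᵐ s ∂ρ, 0 < s)
    {F K : ℝ → ℝ} {t M r : ℝ} (hr0 : 0 ≤ r) (hr : r = M + r ^ 2 / 2)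
    (hF : ∀ u ∈ Set.Icc 0 t, |F u| ≤ M) (hK : ∃ B : ℝ, ∀ u ∈ Set.Icc 0 t, |K u| ≤ B)
    (heq : ∀ u ∈ Set.Icc 0 t, K u = F u + 2⁻¹ * mconv (fun v => (K v) ^ 2) ρ u) :
    ∀ u ∈ Set.Icc 0 t, |K u| ≤ r := by
  obtain ⟨B, hB, hrB⟩ : ∃ B : ℝ, (∀ u ∈ Set.Icc 0 t, |K u| ≤ B) ∧ r ≤ B := by
    obtain ⟨B, hB⟩ := hK
    exact ⟨max B r, fun u hu => (hB u hu).trans (le_max_left _ _), le_max_right _ _⟩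
  have hB0 : 0 ≤ B := hr0.trans hrB
  obtain ⟨n, hn⟩ : ∃ n : ℕ, B * ∫ s, Real.exp (-(n * s)) ∂ρ < 1 / 2 := by
    have h := (tendsto_integral_exp_neg_nat_mul ρ hpos).const_mul B
    rw [mul_zero] at h
    exact (h.eventually_lt_const (by norm_num)).exists
  have hint : Integrable (fun s => Real.exp (-((n : ℝ) * s))) ρ := by
    refine Integrable.of_bound (by fun_prop) 1 ?_
    filter_upwards [hpos] with s hs
    rw [Real.norm_eq_abs, Real.abs_exp, Real.exp_le_one_iff]
    have : (0 : ℝ) ≤ n * s := by positivity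
    linarith
  have hiter : ∀ k : ℕ, ∀ u ∈ Set.Icc 0 t,
      |K u| ≤ r + (B * (1 / 2) ^ k) * Real.exp (n * u) := by
    intro k
    induction k with
    | zero =>
      intro u hu
      have h1 : 1 ≤ Real.exp (n * u) :=
        Real.one_le_exp (mul_nonneg (Nat.cast_nonneg n) hu.1)
      have h2 : B ≤ B * Real.exp (n * u) := le_mul_of_one_le_right hB0 h1
      have h3 := hB u hu
      simpa using by linarith
    | succ k ih =>
      intro u hu
      set C : ℝ := B * (1 / 2) ^ k with hC
      have hC0 : 0 ≤ C := by positivity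
      have hsq : ∀ v ∈ Set.Icc 0 u, K v ^ 2 ≤ r ^ 2 + (2 * B * C) * Real.exp (n * v) := by
        intro v hv
        have hvt : v ∈ Set.Icc 0 t := ⟨hv.1, hv.2.trans hu.2⟩
        have h1 := ih v hvt
        have h2 := hB v hvt
        have h0 := abs_nonneg (K v)
        have he : 0 ≤ C * Real.exp (n * v) := by positivity
        rw [← sq_abs]
        rcases le_total (|K v|) r with h | h
        · nlinarith [mul_nonneg hB0 he]
        · nlinarith [mul_le_mul (show |K v| - r ≤ C * Real.exp (n * v) by linarith)
            (show |K v| + r ≤ 2 * B by linarith) (by linarith) he]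
      have hconv := mconv_le_of_le_const_add_exp ρ (g := fun v => K v ^ 2)
        (fun v => sq_nonneg _) (sq_nonneg r) (by positivity) hint hsq
      have hnonneg := mconv_nonneg (g := fun v => K v ^ 2) (fun v => sq_nonneg _) ρ u
      have hhalf : C * Real.exp (n * u) * (B * ∫ s, Real.exp (-(n * s)) ∂ρ)
          ≤ C * Real.exp (n * u) * (1 / 2) :=
        mul_le_mul_of_nonneg_left hn.le (by positivity)
      have hpow : B * (1 / 2) ^ (k + 1) = C / 2 := by rw [hC]; ring
      have hFu := abs_le.1 (hF u hu)
      rw [hpow, heq u hu, abs_le]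
      constructor <;> nlinarith
  intro u hu
  have hlim : Filter.Tendsto (fun k : ℕ => r + (B * (1 / 2) ^ k) * Real.exp (n * u))
      Filter.atTop (nhds r) := by
    have h := (((tendsto_pow_atTop_nhds_zero_of_lt_one (r := (1 / 2 : ℝ)) (by norm_num)
      (by norm_num)).const_mul B).mul_const (Real.exp (n * u))).const_add r
    simpa using h
  exact ge_of_tendsto' hlim fun k => hiter k u hu

/-- A priori bounds for the convolutional Riccati equation:
if `|F| ≤ 1/2` on `[0,T]` and `K = F + ½(K²)*ρ` on `[0,T]`, then for each
`t ∈ [0,T]`, writing `M_t = sup_{u ∈ [0,t]} |F(u)|`, we have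
`-M_t ≤ K(t) ≤ 1 - √(1 - 2 M_t)`. -/
theorem stmt_8 (T : ℝ) (hT : 0 ≤ T)
    (ρ : Measure ℝ) [IsProbabilityMeasure ρ]
    (hρ0 : ρ {0} = 0) (hρpos : ρ (Set.Iio 0) = 0)
    (F K : ℝ → ℝ) (hFmeas : Measurable F) (hKmeas : Measurable K)
    (hFbdd : ∀ t ∈ Set.Icc 0 T, |F t| ≤ 1 / 2)
    (hKbdd : ∃ M : ℝ, ∀ t ∈ Set.Icc 0 T, |K t| ≤ M)
    (heq : ∀ t ∈ Set.Icc 0 T, K t = F t + 2⁻¹ * mconv (fun u => (K u) ^ 2) ρ t) :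
    ∀ t ∈ Set.Icc 0 T,
      -sSup ((fun u => |F u|) '' Set.Icc 0 t) ≤ K t ∧
      K t ≤ 1 - Real.sqrt (1 - 2 * sSup ((fun u => |F u|) '' Set.Icc 0 t)) := by
  intro t ht
  have hsub : ∀ u ∈ Set.Icc 0 t, u ∈ Set.Icc 0 T := fun u hu => ⟨hu.1, hu.2.trans ht.2⟩
  have htt : t ∈ Set.Icc 0 t := ⟨ht.1, le_rfl⟩
  have hbdd : BddAbove ((fun u => |F u|) '' Set.Icc 0 t) :=
    ⟨1 / 2, Set.forall_mem_image.2 fun u hu => hFbdd u (hsub u hu)⟩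
  set M := sSup ((fun u => |F u|) '' Set.Icc 0 t)
  have hFM : ∀ u ∈ Set.Icc 0 t, |F u| ≤ M := fun u hu =>
    le_csSup hbdd (Set.mem_image_of_mem _ hu)
  have hM : M ≤ 1 / 2 := csSup_le (Set.Nonempty.image _ ⟨t, htt⟩)
    (Set.forall_mem_image.2 fun u hu => hFbdd u (hsub u hu))
  have hM0 : 0 ≤ M := (abs_nonneg _).trans (hFM t htt)
  have hpos : ∀ᵐ s ∂ρ, 0 < s := by
    refine measure_mono_null (fun s hs => ?_) (measure_union_null hρpos hρ0)
    rcases (not_lt.1 (show ¬ 0 < s from hs)).lt_or_eq with h | h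
    · exact Or.inl h
    · exact Or.inr h
  constructor
  · have h := mconv_nonneg (g := fun v => K v ^ 2) (fun v => sq_nonneg _) ρ t
    have hF := (abs_le.1 (hFM t htt)).1
    rw [heq t ht]
    linarith
  · have hsqrt : Real.sqrt (1 - 2 * M) ≤ 1 := Real.sqrt_le_one.2 (by linarith)
    have hsq := Real.sq_sqrt (show 0 ≤ 1 - 2 * M by linarith)
    obtain ⟨B, hB⟩ := hKbdd
    exact (le_abs_self _).trans (abs_le_of_riccati ρ hpos (M := M) (by linarith) (by nlinarith)
      hFM ⟨B, fun u hu => hB u (hsub u hu)⟩ (fun u hu => heq u (hsub u hu)) t htt)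
end

section
/- Let T ≥ 0, let ρ be a Borel probability measure on [0,∞) with ρ({0}) = 0, and let M ≥ 0. There exists a constant C, depending only on ρ, M and T, such that whenever K₁, K₂, F₁, F₂ are bounded Borel functions on [0,T] with sup|K_i| ≤ M and K_i = F_i + ½(K_i²)*ρ on [0,T] for i = 1,2, one has ∫_0^T sup_{u∈[0,t]}|K₂(u) − K₁(u)| dt ≤ C ∫_0^T sup_{u∈[0,t]}|F₂(u) − F₁(u)| dt. In particular, for each bounded Borel F the convolutional Riccati equation K = F + ½(K²)*ρ has at most one bounded Borel solution on [0,T]. -/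
open MeasureTheory

open Set Filter Topology

lemma exists_measure_Icc_small (ρ : Measure ℝ) [IsFiniteMeasure ρ] (hρ0 : ρ {0} = 0)
    {ε : ℝ} (hε : 0 < ε) : ∃ δ > 0, ρ.real (Icc 0 δ) ≤ ε := by
  have h := tendsto_measure_Icc_nhdsWithin_right ρ (0 : ℝ)
  rw [hρ0] at h
  have h1 := h.eventually_lt_const (ENNReal.ofReal_pos.2 hε)
  obtain ⟨δ, h2, hδ⟩ := ((h1.filter_mono (nhdsWithin_mono _ Ioi_subset_Ici_self)).and
    self_mem_nhdsWithin).exists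
  refine ⟨δ, hδ, ENNReal.toReal_le_of_le_ofReal hε.le (le_trans (measure_mono ?_) h2.le)⟩
  have hδ' : (0 : ℝ) < δ := hδ
  exact Icc_subset_Icc (by linarith) (by linarith)

lemma integrableOn_sq_comp_sub (ρ : Measure ℝ) [IsFiniteMeasure ρ] {K : ℝ → ℝ}
    (hK : Measurable K) {M t : ℝ} (hKM : ∀ u ∈ Icc 0 t, |K u| ≤ M) :
    IntegrableOn (fun s => K (t - s) ^ 2) (Icc 0 t) ρ := by
  refine Measure.integrableOn_of_bounded (M := M ^ 2) (measure_ne_top _ _)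
    ((hK.comp (measurable_const.sub measurable_id)).pow_const 2).aestronglyMeasurable ?_
  filter_upwards [ae_restrict_mem measurableSet_Icc] with s hs
  have h := hKM (t - s) ⟨by linarith [hs.2], by linarith [hs.1]⟩
  rw [norm_pow, Real.norm_eq_abs]
  gcongr

/-- The difference of `K₁² * ρ` and `K₂² * ρ` at `t`, with the mass of `ρ` split at `δ`. -/
lemma abs_mconv_sq_sub_le (ρ : Measure ℝ) [IsProbabilityMeasure ρ] {K₁ K₂ : ℝ → ℝ}
    (hK₁ : Measurable K₁) (hK₂ : Measurable K₂) {M t δ c d : ℝ} (hM : 0 ≤ M)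
    (hKM₁ : ∀ u ∈ Icc 0 t, |K₁ u| ≤ M) (hKM₂ : ∀ u ∈ Icc 0 t, |K₂ u| ≤ M)
    (hc : 0 ≤ c) (hd : 0 ≤ d) (hKd : ∀ u ∈ Icc 0 t, |K₂ u - K₁ u| ≤ d)
    (hKc : ∀ u ∈ Icc 0 t, u < t - δ → |K₂ u - K₁ u| ≤ c) :
    |mconv (fun u => K₂ u ^ 2) ρ t - mconv (fun u => K₁ u ^ 2) ρ t| ≤
      2 * M * (ρ.real (Icc 0 δ) * d + c) := by
  let g : ℝ → ℝ := fun s => (Icc 0 δ).indicator (fun _ => 2 * M * d) s + 2 * M * c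
  have hgi : Integrable (fun s => (Icc 0 δ).indicator (fun _ => 2 * M * d) s) ρ :=
    (integrable_const _).indicator measurableSet_Icc
  have hg : Integrable g ρ := hgi.add (integrable_const _)
  have hg0 : 0 ≤ g := fun s =>
    add_nonneg (indicator_nonneg (fun _ _ => by positivity) s) (by positivity)
  unfold mconv
  rw [← integral_sub (integrableOn_sq_comp_sub ρ hK₂ hKM₂) (integrableOn_sq_comp_sub ρ hK₁ hKM₁),
    ← Real.norm_eq_abs]
  calc _ ≤ ∫ s in Icc 0 t, g s ∂ρ := by
        refine norm_integral_le_of_norm_le hg.integrableOn ?_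
        filter_upwards [ae_restrict_mem measurableSet_Icc] with s hs
        have hu : t - s ∈ Icc 0 t := ⟨by linarith [hs.2], by linarith [hs.1]⟩
        have hsum : |K₂ (t - s) + K₁ (t - s)| ≤ 2 * M :=
          (abs_add_le _ _).trans (by linarith [hKM₁ _ hu, hKM₂ _ hu])
        rw [sq_sub_sq, norm_mul, Real.norm_eq_abs, Real.norm_eq_abs]
        by_cases hsδ : s ∈ Icc 0 δ
        · have : 0 ≤ 2 * M * c := by positivity
          simp only [g, indicator_of_mem hsδ]
          linarith [mul_le_mul hsum (hKd _ hu) (abs_nonneg _) (by positivity)]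
        · have hlt : δ < s := by
            by_contra! h
            exact hsδ ⟨hs.1, h⟩
          simp only [g, indicator_of_notMem hsδ, zero_add]
          exact mul_le_mul hsum (hKc _ hu (by linarith)) (abs_nonneg _) (by positivity)
    _ ≤ ∫ s, g s ∂ρ := setIntegral_le_integral hg (Eventually.of_forall hg0)
    _ = _ := by
        simp only [g]
        rw [integral_add hgi (integrable_const _), integral_indicator_const _ measurableSet_Icc]
        simp
        ring

/-- Stability on `[0, nδ)` by induction on the number of steps of length `δ`. -/
lemma exists_riccati_stability_of_lt (ρ : Measure ℝ) [IsProbabilityMeasure ρ] {M δ : ℝ}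
    (hM : 0 ≤ M) (hδ : M * ρ.real (Icc 0 δ) ≤ 1 / 2) (n : ℕ) :
    ∃ C : ℝ, 0 ≤ C ∧ ∀ (T : ℝ) (K₁ K₂ F₁ F₂ : ℝ → ℝ), Measurable K₁ → Measurable K₂ →
      (∀ t ∈ Icc 0 T, |K₁ t| ≤ M) → (∀ t ∈ Icc 0 T, |K₂ t| ≤ M) →
      (∀ t ∈ Icc 0 T, K₁ t = F₁ t + 2⁻¹ * mconv (fun u => K₁ u ^ 2) ρ t) →
      (∀ t ∈ Icc 0 T, K₂ t = F₂ t + 2⁻¹ * mconv (fun u => K₂ u ^ 2) ρ t) →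
      ∀ t ∈ Icc 0 T, t < n * δ → ∀ ε : ℝ, (∀ u ∈ Icc 0 t, |F₂ u - F₁ u| ≤ ε) →
        |K₂ t - K₁ t| ≤ C * ε := by
  induction n with
  | zero =>
    refine ⟨0, le_rfl, fun T K₁ K₂ F₁ F₂ _ _ _ _ _ _ t ht htn => ?_⟩
    have := ht.1
    simp at htn
    linarith
  | succ n ih =>
    obtain ⟨C, hC, ih⟩ := ih
    refine ⟨2 + 2 * M * C, by positivity, ?_⟩
    intro T K₁ K₂ F₁ F₂ hK₁ hK₂ hM₁ hM₂ hR₁ hR₂ t ht htn ε hε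
    have hε0 : 0 ≤ ε := (abs_nonneg _).trans (hε t ⟨ht.1, le_rfl⟩)
    set S : Set ℝ := (fun u => |K₂ u - K₁ u|) '' Icc 0 t
    have hS : BddAbove S := by
      refine ⟨2 * M, ?_⟩
      rintro _ ⟨u, hu, rfl⟩
      have hu' : u ∈ Icc 0 T := ⟨hu.1, hu.2.trans ht.2⟩
      exact (abs_sub _ _).trans (by linarith [hM₁ u hu', hM₂ u hu'])
    have hle : ∀ u ∈ Icc 0 t, |K₂ u - K₁ u| ≤ sSup S := fun u hu => le_csSup hS ⟨u, hu, rfl⟩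
    have htt : t ∈ Icc 0 t := ⟨ht.1, le_rfl⟩
    have hd : 0 ≤ sSup S := (abs_nonneg _).trans (hle t htt)
    have key : sSup S ≤ ε + M * (ρ.real (Icc 0 δ) * sSup S + C * ε) := by
      refine csSup_le ⟨_, t, htt, rfl⟩ ?_
      rintro _ ⟨u, hu, rfl⟩
      have hu' : u ∈ Icc 0 T := ⟨hu.1, hu.2.trans ht.2⟩
      have hsub : Icc 0 u ⊆ Icc 0 T := Icc_subset_Icc le_rfl hu'.2
      have hsub' : Icc 0 u ⊆ Icc 0 t := Icc_subset_Icc le_rfl hu.2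
      have hconv := abs_mconv_sq_sub_le ρ hK₁ hK₂ (δ := δ) (c := C * ε) hM
        (fun v hv => hM₁ v (hsub hv)) (fun v hv => hM₂ v (hsub hv)) (by positivity) hd
        (fun v hv => hle v (hsub' hv)) (fun v hv hvδ => by
          refine ih T K₁ K₂ F₁ F₂ hK₁ hK₂ hM₁ hM₂ hR₁ hR₂ v (hsub hv) ?_ ε
            (fun w hw => hε w ⟨hw.1, hw.2.trans (hv.2.trans hu.2)⟩)
          push_cast at htn
          linarith [hu.2])
      have hF := hε u hu
      have h₁ := hR₁ u hu'
      have h₂ := hR₂ u hu'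
      simp only
      rw [abs_le] at hconv hF ⊢
      constructor <;> linarith [hconv.1, hconv.2, hF.1, hF.2]
    have := mul_le_mul_of_nonneg_right hδ hd
    have := hle t htt
    linarith

/-- Pointwise stability of the convolutional Riccati equation. -/
lemma exists_riccati_stability (T : ℝ) (ρ : Measure ℝ) [IsProbabilityMeasure ρ]
    (hρ0 : ρ {0} = 0) {M : ℝ} (hM : 0 ≤ M) :
    ∃ C : ℝ, ∀ K₁ K₂ F₁ F₂ : ℝ → ℝ, Measurable K₁ → Measurable K₂ →
      (∀ t ∈ Icc 0 T, |K₁ t| ≤ M) → (∀ t ∈ Icc 0 T, |K₂ t| ≤ M) →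
      (∀ t ∈ Icc 0 T, K₁ t = F₁ t + 2⁻¹ * mconv (fun u => K₁ u ^ 2) ρ t) →
      (∀ t ∈ Icc 0 T, K₂ t = F₂ t + 2⁻¹ * mconv (fun u => K₂ u ^ 2) ρ t) →
      ∀ t ∈ Icc 0 T, ∀ ε : ℝ, (∀ u ∈ Icc 0 t, |F₂ u - F₁ u| ≤ ε) →
        |K₂ t - K₁ t| ≤ C * ε := by
  obtain ⟨δ, hδ, hρδ⟩ := exists_measure_Icc_small ρ hρ0 (ε := 1 / (2 * (M + 1))) (by positivity)
  have hMδ : M * ρ.real (Icc 0 δ) ≤ 1 / 2 := by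
    rw [le_div_iff₀ (by positivity)] at hρδ
    linarith [measureReal_nonneg (μ := ρ) (s := Icc 0 δ)]
  obtain ⟨n, hn⟩ := exists_nat_gt (T / δ)
  rw [div_lt_iff₀ hδ] at hn
  obtain ⟨C, -, h⟩ := exists_riccati_stability_of_lt ρ hM hMδ n
  exact ⟨C, fun K₁ K₂ F₁ F₂ hK₁ hK₂ hM₁ hM₂ hR₁ hR₂ t ht =>
    h T K₁ K₂ F₁ F₂ hK₁ hK₂ hM₁ hM₂ hR₁ hR₂ t ht (ht.2.trans_lt hn)⟩

lemma integrableOn_sSup_image_Icc {f : ℝ → ℝ} {T : ℝ} (hf : BddAbove (f '' Icc 0 T)) :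
    IntegrableOn (fun t => sSup (f '' Icc 0 t)) (Icc 0 T) := by
  refine MonotoneOn.integrableOn_isCompact isCompact_Icc fun s hs t ht hst => ?_
  exact csSup_le_csSup (hf.mono (image_mono (Icc_subset_Icc le_rfl ht.2)))
    ⟨_, 0, ⟨le_rfl, hs.1⟩, rfl⟩ (image_mono (Icc_subset_Icc le_rfl hst))

/-- Stability of the convolutional Riccati equation: there is a
constant `C = C(ρ, M, T)` such that any two bounded (by `M`) Borel solutions
`K_i = F_i + ½(K_i²)*ρ` satisfy
`∫₀ᵀ sup_{[0,t]}|K₂-K₁| dt ≤ C ∫₀ᵀ sup_{[0,t]}|F₂-F₁| dt`;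
in particular the equation has at most one bounded Borel solution. -/
theorem stmt_9 (T : ℝ) (hT : 0 ≤ T)
    (ρ : Measure ℝ) [IsProbabilityMeasure ρ]
    (hρ0 : ρ {0} = 0) (hρpos : ρ (Set.Iio 0) = 0)
    (M : ℝ) (hM : 0 ≤ M) :
    (∃ C : ℝ, ∀ K₁ K₂ F₁ F₂ : ℝ → ℝ,
      Measurable K₁ → Measurable K₂ → Measurable F₁ → Measurable F₂ →
      (∀ t ∈ Set.Icc 0 T, |K₁ t| ≤ M) → (∀ t ∈ Set.Icc 0 T, |K₂ t| ≤ M) →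
      (∀ t ∈ Set.Icc 0 T, K₁ t = F₁ t + 2⁻¹ * mconv (fun u => (K₁ u) ^ 2) ρ t) →
      (∀ t ∈ Set.Icc 0 T, K₂ t = F₂ t + 2⁻¹ * mconv (fun u => (K₂ u) ^ 2) ρ t) →
      ∫ t in Set.Icc 0 T, sSup ((fun u => |K₂ u - K₁ u|) '' Set.Icc 0 t) ≤
        C * ∫ t in Set.Icc 0 T, sSup ((fun u => |F₂ u - F₁ u|) '' Set.Icc 0 t)) ∧
    (∀ F K₁ K₂ : ℝ → ℝ,
      Measurable K₁ → Measurable K₂ → Measurable F →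
      (∃ M₁ : ℝ, ∀ t ∈ Set.Icc 0 T, |K₁ t| ≤ M₁) →
      (∃ M₂ : ℝ, ∀ t ∈ Set.Icc 0 T, |K₂ t| ≤ M₂) →
      (∀ t ∈ Set.Icc 0 T, K₁ t = F t + 2⁻¹ * mconv (fun u => (K₁ u) ^ 2) ρ t) →
      (∀ t ∈ Set.Icc 0 T, K₂ t = F t + 2⁻¹ * mconv (fun u => (K₂ u) ^ 2) ρ t) →
      ∀ t ∈ Set.Icc 0 T, K₁ t = K₂ t) := by
  refine ⟨?_, ?_⟩
  · obtain ⟨C, hC⟩ := exists_riccati_stability T ρ hρ0 hM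
    refine ⟨max C 0, fun K₁ K₂ F₁ F₂ hK₁ hK₂ _ _ hM₁ hM₂ hR₁ hR₂ => ?_⟩
    have hKd : ∀ u ∈ Icc 0 T, |K₂ u - K₁ u| ≤ 2 * M := fun u hu =>
      (abs_sub _ _).trans (by linarith [hM₁ u hu, hM₂ u hu])
    have hKb : BddAbove ((fun u => |K₂ u - K₁ u|) '' Icc 0 T) :=
      ⟨2 * M, by rintro _ ⟨u, hu, rfl⟩; exact hKd u hu⟩
    have hFb : BddAbove ((fun u => |F₂ u - F₁ u|) '' Icc 0 T) := by
      refine ⟨2 * M + M * (ρ.real (Icc 0 0) * (2 * M) + 2 * M), ?_⟩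
      rintro _ ⟨u, hu, rfl⟩
      have hsub : Icc 0 u ⊆ Icc 0 T := Icc_subset_Icc le_rfl hu.2
      have hconv := abs_mconv_sq_sub_le ρ hK₁ hK₂ (δ := 0) (c := 2 * M) (d := 2 * M) hM
        (fun v hv => hM₁ v (hsub hv)) (fun v hv => hM₂ v (hsub hv)) (by positivity) (by positivity)
        (fun v hv => hKd v (hsub hv)) (fun v hv _ => hKd v (hsub hv))
      have hK := hKd u hu
      have h₁ := hR₁ u hu
      have h₂ := hR₂ u hu
      simp only
      rw [abs_le] at hconv hK ⊢
      constructor <;> linarith [hconv.1, hconv.2, hK.1, hK.2]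
    rw [← integral_const_mul]
    refine setIntegral_mono_on (integrableOn_sSup_image_Icc hKb)
      ((integrableOn_sSup_image_Icc hFb).const_mul _) measurableSet_Icc fun t ht => ?_
    have hle : ∀ u ∈ Icc 0 t, |F₂ u - F₁ u| ≤ sSup ((fun u => |F₂ u - F₁ u|) '' Icc 0 t) :=
      fun u hu => le_csSup (hFb.mono (image_mono (Icc_subset_Icc le_rfl ht.2))) ⟨u, hu, rfl⟩
    have h0 := (abs_nonneg _).trans (hle t ⟨ht.1, le_rfl⟩)
    refine csSup_le ⟨_, t, ⟨ht.1, le_rfl⟩, rfl⟩ ?_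
    rintro _ ⟨u, hu, rfl⟩
    refine (hC K₁ K₂ F₁ F₂ hK₁ hK₂ hM₁ hM₂ hR₁ hR₂ u ⟨hu.1, hu.2.trans ht.2⟩ _
      fun v hv => hle v ⟨hv.1, hv.2.trans hu.2⟩).trans ?_
    exact mul_le_mul_of_nonneg_right (le_max_left _ _) h0
  · rintro F K₁ K₂ hK₁ hK₂ _ ⟨M₁, hM₁⟩ ⟨M₂, hM₂⟩ hR₁ hR₂ t ht
    obtain ⟨C, hC⟩ := exists_riccati_stability T ρ hρ0
      (((abs_nonneg _).trans (hM₁ t ht)).trans (le_max_left M₁ M₂))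
    have h := hC K₁ K₂ F F hK₁ hK₂ (fun u hu => (hM₁ u hu).trans (le_max_left _ _))
      (fun u hu => (hM₂ u hu).trans (le_max_right _ _)) hR₁ hR₂ t ht 0 (by simp)
    rw [mul_zero, abs_nonpos_iff, sub_eq_zero] at h
    exact h.symm
end

section
/- Let T ≥ 0 and let ρ be a Borel probability measure on [0,∞) with ρ({0}) = 0. Suppose B, F are bounded Borel functions on [0,T] with ‖B‖_∞ < 1. Then the infinite triangular system K₀ = B; K₁ = F + (K₀K₁)*ρ; K_n = (½ Σ_{i=0}^{n} K_i K_{n−i})*ρ for n ≥ 2, has a unique solution (K_n)_{n≥0} in the space of bounded Borel functions on [0,T]; moreover, there is an absolute constant C such that ‖K_n‖_∞ ≤ C · n^{−3/2} · (2‖F‖_∞ / (1 − ‖B‖_∞)²)^n for all n ≥ 1. -/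
open MeasureTheory

/-- The supremum norm of a function over `[0,T]`. -/
noncomputable def supNorm (g : ℝ → ℝ) (T : ℝ) : ℝ :=
  sSup ((fun t => |g t|) '' Set.Icc 0 T)

/-- `K : ℕ → ℝ → ℝ` is a bounded Borel solution on `[0,T]` of the infinite
triangular system `K₀ = B`, `K₁ = F + (K₀K₁)*ρ`,
`K_n = (½ Σ_{i=0}^{n} K_i K_{n-i})*ρ` for `n ≥ 2`. -/
def SolvesSystem (T : ℝ) (ρ : Measure ℝ) (B F : ℝ → ℝ) (K : ℕ → ℝ → ℝ) : Prop :=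
  (∀ n, Measurable (K n)) ∧
  (∀ n, ∃ M : ℝ, ∀ t ∈ Set.Icc 0 T, |K n t| ≤ M) ∧
  (∀ t ∈ Set.Icc 0 T, K 0 t = B t) ∧
  (∀ t ∈ Set.Icc 0 T, K 1 t = F t + mconv (fun u => K 0 u * K 1 u) ρ t) ∧
  (∀ n, 2 ≤ n → ∀ t ∈ Set.Icc 0 T,
    K n t = mconv (fun u => 2⁻¹ * ∑ i ∈ Finset.range (n + 1), K i u * K (n - i) u) ρ t)

lemma mconv_congr {g h : ℝ → ℝ} {T t : ℝ} (ρ : Measure ℝ) (ht : t ∈ Set.Icc 0 T)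
    (hgh : ∀ s ∈ Set.Icc 0 T, g s = h s) : mconv g ρ t = mconv h ρ t := by
  refine setIntegral_congr_fun measurableSet_Icc fun s hs => hgh _ ?_
  exact ⟨by linarith [hs.2], by linarith [hs.1, ht.2]⟩

lemma abs_mconv_le {g : ℝ → ℝ} {T t M : ℝ} (ρ : Measure ℝ) [IsProbabilityMeasure ρ]
    (hM : 0 ≤ M) (ht : t ∈ Set.Icc 0 T) (hg : ∀ s ∈ Set.Icc 0 T, |g s| ≤ M) :
    |mconv g ρ t| ≤ M := by
  have h := norm_setIntegral_le_of_norm_le_const (μ := ρ) (s := Set.Icc 0 t)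
    (f := fun s => g (t - s)) (C := M) (measure_lt_top _ _)
    (fun s hs => hg _ ⟨by linarith [hs.2], by linarith [hs.1, ht.2]⟩)
  refine h.trans ?_
  have : ρ.real (Set.Icc 0 t) ≤ 1 := measureReal_le_one
  nlinarith

lemma integrableOn_comp_sub {g : ℝ → ℝ} {T t M : ℝ} (ρ : Measure ℝ) [IsProbabilityMeasure ρ]
    (ht : t ∈ Set.Icc 0 T) (hgm : Measurable g) (hg : ∀ s ∈ Set.Icc 0 T, |g s| ≤ M) :
    IntegrableOn (fun s => g (t - s)) (Set.Icc 0 t) ρ := by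
  refine IntegrableOn.of_bound (measure_lt_top _ _)
    (hgm.comp (measurable_const.sub measurable_id)).aestronglyMeasurable M ?_
  refine (ae_restrict_iff' measurableSet_Icc).2 (ae_of_all _ fun s hs => hg _ ?_)
  exact ⟨by linarith [hs.2], by linarith [hs.1, ht.2]⟩

lemma mconv_add {g h : ℝ → ℝ} {T t M N : ℝ} (ρ : Measure ℝ) [IsProbabilityMeasure ρ]
    (ht : t ∈ Set.Icc 0 T) (hgm : Measurable g) (hhm : Measurable h)
    (hg : ∀ s ∈ Set.Icc 0 T, |g s| ≤ M) (hh : ∀ s ∈ Set.Icc 0 T, |h s| ≤ N) :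
    mconv (fun s => g s + h s) ρ t = mconv g ρ t + mconv h ρ t :=
  integral_add (integrableOn_comp_sub ρ ht hgm hg) (integrableOn_comp_sub ρ ht hhm hh)

lemma mconv_sub {g h : ℝ → ℝ} {T t M N : ℝ} (ρ : Measure ℝ) [IsProbabilityMeasure ρ]
    (ht : t ∈ Set.Icc 0 T) (hgm : Measurable g) (hhm : Measurable h)
    (hg : ∀ s ∈ Set.Icc 0 T, |g s| ≤ M) (hh : ∀ s ∈ Set.Icc 0 T, |h s| ≤ N) :
    mconv (fun s => g s - h s) ρ t = mconv g ρ t - mconv h ρ t :=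
  integral_sub (integrableOn_comp_sub ρ ht hgm hg) (integrableOn_comp_sub ρ ht hhm hh)

lemma measurable_mconv {g : ℝ → ℝ} (ρ : Measure ℝ) [IsProbabilityMeasure ρ]
    (hg : Measurable g) : Measurable (mconv g ρ) := by
  have h : mconv g ρ =
      fun t => ∫ s, {p : ℝ × ℝ | 0 ≤ p.2 ∧ p.2 ≤ p.1}.indicator (fun p => g (p.1 - p.2)) (t, s) ∂ρ := by
    funext t
    rw [mconv, ← integral_indicator measurableSet_Icc]
    rfl
  rw [h]
  refine (StronglyMeasurable.integral_prod_right' (ν := ρ) ?_).measurable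
  refine (Measurable.indicator (by fun_prop) ?_).stronglyMeasurable
  exact (measurableSet_le measurable_const measurable_snd).inter
    (measurableSet_le measurable_snd measurable_fst)

/-- The terms of the Neumann series of the linear Volterra equation `u = G + (B u) * ρ`. -/
noncomputable def neumannTerm (ρ : Measure ℝ) (B G : ℝ → ℝ) : ℕ → ℝ → ℝ
  | 0 => G
  | n + 1 => mconv (fun u => B u * neumannTerm ρ B G n u) ρ

lemma measurable_neumannTerm (ρ : Measure ℝ) [IsProbabilityMeasure ρ] {B G : ℝ → ℝ}
    (hB : Measurable B) (hG : Measurable G) (n : ℕ) : Measurable (neumannTerm ρ B G n) := by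
  induction n with
  | zero => exact hG
  | succ n ih => exact measurable_mconv ρ (hB.mul ih)

lemma abs_mconv_le_of_forall {g : ℝ → ℝ} {M : ℝ} (ρ : Measure ℝ) [IsProbabilityMeasure ρ]
    (hg : ∀ s, |g s| ≤ M) (t : ℝ) : |mconv g ρ t| ≤ M := by
  have hM : 0 ≤ M := (abs_nonneg _).trans (hg 0)
  rcases lt_or_ge t 0 with ht | ht
  · simp [mconv, Set.Icc_eq_empty_of_lt ht, hM]
  · exact abs_mconv_le ρ hM (Set.right_mem_Icc.2 ht) fun s _ => hg s

lemma abs_neumannTerm_le (ρ : Measure ℝ) [IsProbabilityMeasure ρ] {B G : ℝ → ℝ} {b M : ℝ}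
    (hB : ∀ t, |B t| ≤ b) (hG : ∀ t, |G t| ≤ M) (n : ℕ) (t : ℝ) :
    |neumannTerm ρ B G n t| ≤ M * b ^ n := by
  induction n generalizing t with
  | zero => simpa [neumannTerm] using hG t
  | succ n ih =>
    refine abs_mconv_le_of_forall ρ (fun s => ?_) t
    have hb : 0 ≤ b := (abs_nonneg _).trans (hB 0)
    rw [abs_mul]
    calc _ ≤ b * (M * b ^ n) := mul_le_mul (hB s) (ih s) (abs_nonneg _) hb
      _ = _ := by ring

lemma exists_volterra_solution (ρ : Measure ℝ) [IsProbabilityMeasure ρ] {B G : ℝ → ℝ} {b M : ℝ}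
    (hBm : Measurable B) (hGm : Measurable G) (hb : b < 1)
    (hB : ∀ t, |B t| ≤ b) (hG : ∀ t, |G t| ≤ M) :
    ∃ u : ℝ → ℝ, (Measurable u ∧ ∃ N, ∀ t, |u t| ≤ N) ∧
      ∀ t, u t = G t + mconv (fun s => B s * u s) ρ t := by
  have hb0 : 0 ≤ b := (abs_nonneg _).trans (hB 0)
  set v := neumannTerm ρ B G
  have hvm : ∀ n, Measurable (v n) := measurable_neumannTerm ρ hBm hGm
  have hvb : ∀ n t, |v n t| ≤ M * b ^ n := abs_neumannTerm_le ρ hB hG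
  have hgeo : Summable fun n : ℕ => M * b ^ n := (summable_geometric_of_lt_one hb0 hb).mul_left M
  have hsum : ∀ t, Summable fun n => v n t := fun t =>
    Summable.of_norm_bounded hgeo fun n => hvb n t
  refine ⟨fun t => ∑' n, v n t, ⟨?_, ∑' n : ℕ, M * b ^ n, fun t => ?_⟩, fun t => ?_⟩
  · exact measurable_of_tendsto_metrizable
      (f := fun n t => ∑ i ∈ Finset.range n, v i t) (fun n => by fun_prop)
      (tendsto_pi_nhds.2 fun t => (hsum t).hasSum.tendsto_sum_nat)
  · exact tsum_of_norm_bounded (f := fun n => v n t) hgeo.hasSum fun n => hvb n t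
  · dsimp only
    rw [(hsum t).tsum_eq_zero_add]
    congr 1
    have hbound : ∀ n s, ‖B (t - s) * v n (t - s)‖ ≤ M * b ^ n := fun n s => by
      rw [norm_mul]
      calc _ ≤ 1 * (M * b ^ n) :=
            mul_le_mul ((hB _).trans hb.le) (hvb n _) (abs_nonneg _) zero_le_one
        _ = _ := one_mul _
    have hint : ∀ n, Integrable (fun s => B (t - s) * v n (t - s)) (ρ.restrict (Set.Icc 0 t)) :=
      fun n => Integrable.of_bound (by fun_prop) _ (ae_of_all _ (hbound n))
    have hs : Summable fun n => ∫ s in Set.Icc 0 t, ‖B (t - s) * v n (t - s)‖ ∂ρ := by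
      refine Summable.of_nonneg_of_le (fun n => integral_nonneg fun s => norm_nonneg _)
        (fun n => ?_) hgeo
      have h := norm_setIntegral_le_of_norm_le_const (μ := ρ) (s := Set.Icc 0 t)
        (f := fun s => ‖B (t - s) * v n (t - s)‖) (C := M * b ^ n) (measure_lt_top _ _)
        (fun s _ => by simpa using hbound n s)
      refine (le_abs_self _).trans (h.trans ?_)
      exact mul_le_of_le_one_right ((norm_nonneg _).trans (hbound n 0)) measureReal_le_one
    have h := integral_tsum_of_summable_integral_norm hint hs
    simp only [tsum_mul_left] at h
    exact h

/-- Course-of-values recursion: `next n p` computes the `n`-th term from the previous ones, and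
the values of `p` from index `n` on are `default`. -/
noncomputable def courseOfValues {α : Type*} [Inhabited α] (next : ℕ → (ℕ → α) → α) (n : ℕ) : α :=
  next n fun i => if _ : i < n then courseOfValues next i else default

lemma supNorm_le {g : ℝ → ℝ} {T M : ℝ} (hT : 0 ≤ T) (h : ∀ t ∈ Set.Icc 0 T, |g t| ≤ M) :
    supNorm g T ≤ M := by
  refine csSup_le ((Set.nonempty_Icc.2 hT).image _) ?_
  rintro _ ⟨t, ht, rfl⟩
  exact h t ht

lemma abs_le_supNorm {g : ℝ → ℝ} {T : ℝ} (h : ∃ M, ∀ t ∈ Set.Icc 0 T, |g t| ≤ M) :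
    ∀ t ∈ Set.Icc 0 T, |g t| ≤ supNorm g T := by
  intro t ht
  obtain ⟨M, hM⟩ := h
  refine le_csSup ⟨M, ?_⟩ ⟨t, ht, rfl⟩
  rintro _ ⟨s, hs, rfl⟩
  exact hM s hs

lemma supNorm_nonneg (g : ℝ → ℝ) (T : ℝ) : 0 ≤ supNorm g T := by
  refine Real.sSup_nonneg ?_
  rintro _ ⟨s, -, rfl⟩
  exact abs_nonneg _

lemma half_sum_convolution_eq (a : ℕ → ℝ) (m : ℕ) :
    2⁻¹ * ∑ i ∈ Finset.range (m + 2), a i * a (m + 1 - i) =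
      a 0 * a (m + 1) + 2⁻¹ * ∑ i ∈ Finset.range m, a (i + 1) * a (m - i) := by
  rw [Finset.sum_range_succ, Finset.sum_range_succ']
  simp only [Nat.add_sub_add_right, Nat.sub_zero, Nat.sub_self]
  ring

lemma exists_solvesSystem {T : ℝ} (ρ : Measure ℝ) [IsProbabilityMeasure ρ] {B F : ℝ → ℝ}
    (hBm : Measurable B) (hFm : Measurable F)
    (hB : ∃ M : ℝ, ∀ t ∈ Set.Icc 0 T, |B t| ≤ M) (hF : ∃ M : ℝ, ∀ t ∈ Set.Icc 0 T, |F t| ≤ M)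
    (hb : supNorm B T < 1) : ∃ K, SolvesSystem T ρ B F K := by
  let S := {f : ℝ → ℝ // Measurable f ∧ ∃ N, ∀ t, |f t| ≤ N}
  have extend : ∀ {g : ℝ → ℝ}, Measurable g → (∃ M : ℝ, ∀ t ∈ Set.Icc 0 T, |g t| ≤ M) →
      Measurable ((Set.Icc 0 T).indicator g) ∧
        ∀ t, |(Set.Icc 0 T).indicator g t| ≤ supNorm g T := by
    intro g hgm hg
    refine ⟨hgm.indicator measurableSet_Icc, fun t => ?_⟩
    by_cases ht : t ∈ Set.Icc 0 T
    · rw [Set.indicator_of_mem ht]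
      exact abs_le_supNorm hg t ht
    · rw [Set.indicator_of_notMem ht, abs_zero]
      exact supNorm_nonneg g T
  obtain ⟨hBm', hB'⟩ := extend hBm hB
  obtain ⟨hFm', hF'⟩ := extend hFm hF
  set B' := (Set.Icc 0 T).indicator B
  set F' := (Set.Icc 0 T).indicator F with hF'_def
  have hsource : ∀ (n : ℕ) (p : ℕ → S),
      Measurable (fun u => 2⁻¹ * ∑ i ∈ Finset.range n, (p (i + 1)).1 u * (p (n - i)).1 u) ∧
      ∃ N, ∀ u, |2⁻¹ * ∑ i ∈ Finset.range n, (p (i + 1)).1 u * (p (n - i)).1 u| ≤ N := by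
    intro n p
    choose N hN using fun i => (p i).2.2
    refine ⟨measurable_const.mul (Finset.measurable_sum _
      fun i _ => (p (i + 1)).2.1.mul (p (n - i)).2.1),
      2⁻¹ * ∑ i ∈ Finset.range n, N (i + 1) * N (n - i), fun u => ?_⟩
    rw [abs_mul, abs_of_pos (by norm_num : (0 : ℝ) < 2⁻¹)]
    refine mul_le_mul_of_nonneg_left ((Finset.abs_sum_le_sum_abs _ _).trans
      (Finset.sum_le_sum fun i _ => ?_)) (by norm_num)
    rw [abs_mul]
    exact mul_le_mul (hN _ _) (hN _ _) (abs_nonneg _) ((abs_nonneg _).trans (hN _ u))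
  have hnext : ∀ (n : ℕ) (p : ℕ → S), ∃ k : S,
      (n = 0 → k.1 = B') ∧
      (n = 1 → ∀ t, k.1 t = F' t + mconv (fun u => B' u * k.1 u) ρ t) ∧
      (∀ m, n = m + 2 → ∀ t, k.1 t =
        mconv (fun u => 2⁻¹ * ∑ i ∈ Finset.range (m + 1), (p (i + 1)).1 u * (p (m + 1 - i)).1 u) ρ t
          + mconv (fun u => B' u * k.1 u) ρ t) := by
    intro n p
    match n with
    | 0 => exact ⟨⟨B', hBm', _, hB'⟩, fun _ => rfl, by simp, by simp⟩
    | 1 =>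
      obtain ⟨k, hk, hk'⟩ := exists_volterra_solution ρ hBm' hFm' hb hB' hF'
      exact ⟨⟨k, hk⟩, by simp, fun _ => hk', by simp⟩
    | m + 2 =>
      obtain ⟨hm, N, hN⟩ := hsource (m + 1) p
      obtain ⟨k, hk, hk'⟩ := exists_volterra_solution ρ hBm' (measurable_mconv ρ hm) hb hB'
        (abs_mconv_le_of_forall ρ hN)
      refine ⟨⟨k, hk⟩, by simp, by simp, fun m' h => ?_⟩
      obtain rfl : m = m' := by omega
      exact hk'
  choose next hnext0 hnext1 hnext2 using hnext
  have : Inhabited S := ⟨⟨fun _ => 0, measurable_const, 0, by simp⟩⟩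
  set K : ℕ → S := courseOfValues next with hK
  have hKn : ∀ n, K n = next n fun i => if _ : i < n then K i else default := fun n => by
    rw [hK, courseOfValues]
  have hK0 : (K 0).1 = B' := by rw [hKn]; exact hnext0 0 _ rfl
  have hBB' : ∀ t ∈ Set.Icc 0 T, B' t = B t := fun t ht => Set.indicator_of_mem ht _
  refine ⟨fun n => (K n).1, fun n => (K n).2.1, fun n => ?_, ?_, ?_, ?_⟩
  · obtain ⟨N, hN⟩ := (K n).2.2
    exact ⟨N, fun t _ => hN t⟩
  · intro t ht
    exact (congrFun hK0 t).trans (hBB' t ht)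
  · intro t ht
    have h := hnext1 1 (fun i => if _ : i < 1 then K i else default) rfl t
    rw [← hKn, hF'_def, Set.indicator_of_mem ht] at h
    simpa only [hK0] using h
  · intro n hn t ht
    obtain ⟨m, rfl⟩ := Nat.exists_eq_add_of_le' hn
    have h := hnext2 (m + 2) (fun i => if _ : i < m + 2 then K i else default) m rfl t
    rw [← hKn] at h
    obtain ⟨hm, N, hN⟩ := hsource (m + 1) K
    obtain ⟨N', hN'⟩ := (K (m + 2)).2.2
    have hsplit := fun u => half_sum_convolution_eq (fun i => (K i).1 u) (m + 1)
    simp only [hsplit, hK0]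
    rw [show m + 1 + 1 = m + 2 from rfl, mconv_add (M := N') (N := N) ρ ht (g := fun u => B' u * (K (m + 2)).1 u)
      (hBm'.mul (K (m + 2)).2.1) hm (fun s _ => ?_)
      fun s _ => hN s]
    refine h.trans ((add_comm _ _).trans ?_)
    congr 1
    · refine mconv_congr ρ ht fun u _ => ?_
      congr 1
      refine Finset.sum_congr rfl fun i hi => ?_
      have hi' := Finset.mem_range.1 hi
      rw [dif_pos (by omega), dif_pos (by omega)]
    · rw [abs_mul]
      calc _ ≤ 1 * N' := mul_le_mul ((hB' s).trans hb.le) (hN' s) (abs_nonneg _) zero_le_one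
        _ = N' := one_mul _

namespace SolvesSystem

variable {T : ℝ} {ρ : Measure ℝ} {B F : ℝ → ℝ} {K K' : ℕ → ℝ → ℝ}

lemma abs_le (hK : SolvesSystem T ρ B F K) (n : ℕ) :
    ∀ t ∈ Set.Icc 0 T, |K n t| ≤ supNorm (K n) T :=
  abs_le_supNorm (hK.2.1 n)

lemma abs_mul_le (hK : SolvesSystem T ρ B F K) (i j : ℕ) :
    ∀ t ∈ Set.Icc 0 T, |K i t * K j t| ≤ supNorm (K i) T * supNorm (K j) T := by
  intro t ht
  rw [abs_mul]
  exact mul_le_mul (hK.abs_le i t ht) (hK.abs_le j t ht) (abs_nonneg _) (supNorm_nonneg _ _)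

lemma supNorm_zero (hK : SolvesSystem T ρ B F K) : supNorm (K 0) T = supNorm B T := by
  unfold supNorm
  congr 1
  exact Set.image_congr fun t ht => by rw [hK.2.2.1 t ht]

lemma abs_half_sum_le (hK : SolvesSystem T ρ B F K) (n : ℕ) :
    ∀ t ∈ Set.Icc 0 T, |2⁻¹ * ∑ i ∈ Finset.range (n + 1), K i t * K (n - i) t| ≤
      2⁻¹ * ∑ i ∈ Finset.range (n + 1), supNorm (K i) T * supNorm (K (n - i)) T := by
  intro t ht
  rw [_root_.abs_mul, abs_of_pos (by norm_num : (0 : ℝ) < 2⁻¹)]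
  exact mul_le_mul_of_nonneg_left ((Finset.abs_sum_le_sum_abs _ _).trans
    (Finset.sum_le_sum fun i _ => hK.abs_mul_le i (n - i) t ht)) (by norm_num)

lemma measurable_half_sum (hK : SolvesSystem T ρ B F K) (n : ℕ) :
    Measurable fun t => 2⁻¹ * ∑ i ∈ Finset.range (n + 1), K i t * K (n - i) t :=
  measurable_const.mul (Finset.measurable_sum _ fun i _ => (hK.1 i).mul (hK.1 (n - i)))

lemma supNorm_one_le (hT : 0 ≤ T) [IsProbabilityMeasure ρ] (hK : SolvesSystem T ρ B F K)
    (hF : ∃ M : ℝ, ∀ t ∈ Set.Icc 0 T, |F t| ≤ M) :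
    supNorm (K 1) T ≤ supNorm F T + supNorm B T * supNorm (K 1) T := by
  refine supNorm_le hT fun t ht => ?_
  rw [hK.2.2.2.1 t ht, ← hK.supNorm_zero]
  exact (abs_add_le _ _).trans (add_le_add (abs_le_supNorm hF t ht)
    (abs_mconv_le ρ (mul_nonneg (supNorm_nonneg _ _) (supNorm_nonneg _ _)) ht
      (hK.abs_mul_le 0 1)))

lemma supNorm_add_two_le (hT : 0 ≤ T) [IsProbabilityMeasure ρ] (hK : SolvesSystem T ρ B F K)
    (m : ℕ) :
    supNorm (K (m + 2)) T ≤ supNorm B T * supNorm (K (m + 2)) T +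
      2⁻¹ * ∑ i ∈ Finset.range (m + 1), supNorm (K (i + 1)) T * supNorm (K (m - i + 1)) T := by
  have h0 : ∀ i, 0 ≤ supNorm (K i) T := fun i => supNorm_nonneg _ _
  have hmain : supNorm (K (m + 2)) T ≤
      2⁻¹ * ∑ i ∈ Finset.range (m + 2 + 1), supNorm (K i) T * supNorm (K (m + 2 - i)) T := by
    refine supNorm_le hT fun t ht => ?_
    rw [hK.2.2.2.2 (m + 2) (by omega) t ht]
    exact abs_mconv_le ρ (mul_nonneg (by norm_num)
      (Finset.sum_nonneg fun i _ => mul_nonneg (h0 _) (h0 _))) ht (hK.abs_half_sum_le (m + 2))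
  rw [half_sum_convolution_eq (fun i => supNorm (K i) T) (m + 1), hK.supNorm_zero] at hmain
  refine hmain.trans_eq ?_
  congr 2
  refine Finset.sum_congr rfl fun i hi => ?_
  have hi' := Finset.mem_range.1 hi
  rw [show m + 1 - i = m - i + 1 by omega]

lemma eqOn_of_abs_sub_le (hT : 0 ≤ T) {g h : ℝ → ℝ} {b : ℝ} (hb : b < 1)
    (hbdd : ∃ M, ∀ t ∈ Set.Icc 0 T, |g t - h t| ≤ M)
    (hgh : ∀ t ∈ Set.Icc 0 T, |g t - h t| ≤ b * supNorm (fun t => g t - h t) T) :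
    ∀ t ∈ Set.Icc 0 T, g t = h t := by
  intro t ht
  have h1 := supNorm_le hT hgh
  have h2 := supNorm_nonneg (fun t => g t - h t) T
  have h3 := abs_le_supNorm hbdd t ht
  have h4 : supNorm (fun t => g t - h t) T = 0 := by nlinarith
  rw [h4] at h3
  exact sub_eq_zero.1 (abs_nonpos_iff.1 h3)

lemma unique (hT : 0 ≤ T) [IsProbabilityMeasure ρ]
    (hB : ∃ M : ℝ, ∀ t ∈ Set.Icc 0 T, |B t| ≤ M) (hb : supNorm B T < 1)
    (hK : SolvesSystem T ρ B F K) (hK' : SolvesSystem T ρ B F K') (n : ℕ) :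
    ∀ t ∈ Set.Icc 0 T, K' n t = K n t := by
  have hbdd : ∀ n, ∃ M, ∀ t ∈ Set.Icc 0 T, |K' n t - K n t| ≤ M := fun n =>
    ⟨_, fun t ht => (abs_sub _ _).trans (add_le_add (hK'.abs_le n t ht) (hK.abs_le n t ht))⟩
  have hconv : ∀ n, ∀ t ∈ Set.Icc 0 T, |mconv (fun u => B u * (K' n u - K n u)) ρ t| ≤
      supNorm B T * supNorm (fun t => K' n t - K n t) T := by
    intro n t ht
    refine abs_mconv_le ρ (mul_nonneg (supNorm_nonneg _ _) (supNorm_nonneg _ _)) ht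
      fun s hs => ?_
    rw [abs_mul]
    exact mul_le_mul (abs_le_supNorm hB s hs) (abs_le_supNorm (hbdd n) s hs) (abs_nonneg _)
      (supNorm_nonneg _ _)
  induction n using Nat.strong_induction_on with
  | _ n ih =>
  match n, ih with
  | 0, _ =>
    intro t ht
    rw [hK.2.2.1 t ht, hK'.2.2.1 t ht]
  | 1, _ =>
    refine eqOn_of_abs_sub_le hT hb (hbdd 1) fun t ht => ?_
    refine le_trans (le_of_eq ?_) (hconv 1 t ht)
    rw [hK.2.2.2.1 t ht, hK'.2.2.2.1 t ht, add_sub_add_left_eq_sub,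
      ← mconv_sub (g := fun u => K' 0 u * K' 1 u) (h := fun u => K 0 u * K 1 u) ρ ht ((hK'.1 0).mul (hK'.1 1)) ((hK.1 0).mul (hK.1 1)) (hK'.abs_mul_le 0 1)
        (hK.abs_mul_le 0 1)]
    congr 1
    refine mconv_congr ρ ht fun s hs => ?_
    rw [hK.2.2.1 s hs, hK'.2.2.1 s hs]
    ring
  | m + 2, ih =>
    refine eqOn_of_abs_sub_le hT hb (hbdd (m + 2)) fun t ht => ?_
    refine le_trans (le_of_eq ?_) (hconv (m + 2) t ht)
    rw [hK.2.2.2.2 (m + 2) (by omega) t ht, hK'.2.2.2.2 (m + 2) (by omega) t ht,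
      ← mconv_sub ρ ht (hK'.measurable_half_sum _) (hK.measurable_half_sum _)
        (hK'.abs_half_sum_le _) (hK.abs_half_sum_le _)]
    congr 1
    refine mconv_congr ρ ht fun s hs => ?_
    rw [half_sum_convolution_eq (fun i => K i s) (m + 1),
      half_sum_convolution_eq (fun i => K' i s) (m + 1), hK.2.2.1 s hs, hK'.2.2.1 s hs]
    have hsum : ∑ i ∈ Finset.range (m + 1), K' (i + 1) s * K' (m + 1 - i) s =
        ∑ i ∈ Finset.range (m + 1), K (i + 1) s * K (m + 1 - i) s := by
      refine Finset.sum_congr rfl fun i hi => ?_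
      have hi' := Finset.mem_range.1 hi
      rw [ih (i + 1) (by omega) s hs, ih (m + 1 - i) (by omega) s hs]
    rw [hsum]
    ring

end SolvesSystem

lemma le_catalan_mul_of_convolution_le {c : ℕ → ℝ} {x y : ℝ} (hc : ∀ n, 0 ≤ c n) (hy : 0 ≤ y)
    (h0 : c 0 ≤ x)
    (h : ∀ n, c (n + 1) ≤ y * ∑ i ∈ Finset.range (n + 1), c i * c (n - i)) (n : ℕ) :
    c n ≤ catalan n * (x ^ (n + 1) * y ^ n) := by
  have hx : 0 ≤ x := (hc 0).trans h0
  induction n using Nat.strong_induction_on with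
  | _ n ih =>
  match n, ih with
  | 0, _ => simpa using h0
  | n + 1, ih =>
    refine (h n).trans ?_
    rw [catalan_succ, Fin.sum_univ_eq_sum_range (fun i => catalan i * catalan (n - i)),
      Nat.cast_sum, Finset.mul_sum, Finset.sum_mul]
    refine Finset.sum_le_sum fun i hi => ?_
    have hi' := Finset.mem_range.1 hi
    obtain ⟨j, rfl⟩ := Nat.exists_eq_add_of_le (Nat.lt_succ_iff.1 hi')
    rw [Nat.add_sub_cancel_left]
    have h1 := ih i (by omega)
    have h2 := ih j (by omega)
    calc y * (c i * c j) ≤ y * ((catalan i * (x ^ (i + 1) * y ^ i)) *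
          (catalan j * (x ^ (j + 1) * y ^ j))) := by
          have := hc i
          have := hc j
          gcongr
      _ = _ := by push_cast; ring

lemma centralBinom_sq_mul_le (n : ℕ) : n.centralBinom ^ 2 * (3 * n + 1) ≤ 16 ^ n := by
  induction n with
  | zero => simp
  | succ n ih =>
    have h := Nat.succ_mul_centralBinom_succ n
    have hpos : 0 < (n + 1) ^ 2 := by positivity
    refine Nat.le_of_mul_le_mul_left ?_ hpos
    calc (n + 1) ^ 2 * ((n + 1).centralBinom ^ 2 * (3 * (n + 1) + 1))
        = ((n + 1) * (n + 1).centralBinom) ^ 2 * (3 * n + 4) := by ring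
      _ = n.centralBinom ^ 2 * (4 * (2 * n + 1) ^ 2 * (3 * n + 4)) := by rw [h]; ring
      _ ≤ n.centralBinom ^ 2 * (16 * (n + 1) ^ 2 * (3 * n + 1)) :=
          Nat.mul_le_mul_left _ (by nlinarith)
      _ = 16 * (n + 1) ^ 2 * (n.centralBinom ^ 2 * (3 * n + 1)) := by ring
      _ ≤ 16 * (n + 1) ^ 2 * 16 ^ n := Nat.mul_le_mul_left _ ih
      _ = (n + 1) ^ 2 * 16 ^ (n + 1) := by ring

lemma catalan_le (n : ℕ) : (catalan n : ℝ) ≤ 4 ^ n * ((n + 1 : ℕ) : ℝ) ^ (-(3 : ℝ) / 2) := by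
  have hpos : (0 : ℝ) < ((n + 1 : ℕ) : ℝ) := by positivity
  have h1 : ((n + 1 : ℕ) : ℝ) * catalan n = n.centralBinom := by
    exact_mod_cast succ_mul_catalan_eq_centralBinom n
  have h2 : (n.centralBinom : ℝ) ^ 2 * (n + 1 : ℕ) ≤ 16 ^ n := by
    exact_mod_cast (Nat.mul_le_mul_left _ (by omega)).trans (centralBinom_sq_mul_le n)
  refine abs_le_of_sq_le_sq' ?_ (by positivity) |>.2
  have h3 : (((n + 1 : ℕ) : ℝ) ^ (-(3 : ℝ) / 2)) ^ 2 = (((n + 1 : ℕ) : ℝ) ^ 3)⁻¹ := by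
    rw [← Real.rpow_natCast, ← Real.rpow_mul hpos.le,
      show (-(3 : ℝ) / 2 * (2 : ℕ)) = -(3 : ℕ) by norm_num, Real.rpow_neg hpos.le,
      Real.rpow_natCast]
  rw [mul_pow, h3, ← pow_mul, mul_comm n 2, pow_mul, ← div_eq_mul_inv, le_div_iff₀ (by positivity)]
  calc (catalan n : ℝ) ^ 2 * ((n + 1 : ℕ) : ℝ) ^ 3
      = (((n + 1 : ℕ) : ℝ) * catalan n) ^ 2 * (n + 1 : ℕ) := by ring
    _ ≤ 16 ^ n := by rw [h1]; exact h2
    _ = _ := by norm_num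

lemma SolvesSystem.supNorm_succ_le {T : ℝ} {ρ : Measure ℝ} {B F : ℝ → ℝ} {K : ℕ → ℝ → ℝ}
    (hT : 0 ≤ T) [IsProbabilityMeasure ρ] (hK : SolvesSystem T ρ B F K)
    (hF : ∃ M : ℝ, ∀ t ∈ Set.Icc 0 T, |F t| ≤ M) (hb : supNorm B T < 1) (m : ℕ) :
    supNorm (K (m + 1)) T ≤ ((m + 1 : ℕ) : ℝ) ^ (-(3 : ℝ) / 2) *
      (2 * supNorm F T / (1 - supNorm B T) ^ 2) ^ (m + 1) := by
  have hb0 := supNorm_nonneg B T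
  have hf0 := supNorm_nonneg F T
  have h1 := hK.supNorm_one_le hT hF
  have h2 := hK.supNorm_add_two_le hT
  obtain ⟨a, ha⟩ : ∃ a, a = 1 - supNorm B T := ⟨_, rfl⟩
  have ha0 : 0 < a := by linarith
  have ha1 : a ≤ 1 := by linarith
  rw [← ha]
  set f := supNorm F T
  have hcat := le_catalan_mul_of_convolution_le (c := fun n => supNorm (K (n + 1)) T)
    (x := f / a) (y := (2 * a)⁻¹) (fun n => supNorm_nonneg _ _) (by positivity)
    (by rw [le_div_iff₀ ha0, ha]; linarith)
    (fun n => by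
      rw [mul_inv, mul_comm (2⁻¹ : ℝ), mul_assoc, ← div_eq_inv_mul, le_div_iff₀ ha0, ha]
      linarith [h2 n]) m
  calc supNorm (K (m + 1)) T
      ≤ catalan m * ((f / a) ^ (m + 1) * (2 * a)⁻¹ ^ m) := hcat
    _ ≤ (4 ^ m * ((m + 1 : ℕ) : ℝ) ^ (-(3 : ℝ) / 2)) *
          ((f / a) ^ (m + 1) * (2 * a)⁻¹ ^ m) := by
        gcongr
        exact catalan_le m
    _ = (a / 2) * (((m + 1 : ℕ) : ℝ) ^ (-(3 : ℝ) / 2) * (2 * f / a ^ 2) ^ (m + 1)) := by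
        have h4 : 2 * f / a ^ 2 = 4 * (f / a) * (2 * a)⁻¹ := by field_simp; ring
        have h5 : (a / 2) * (4 * (2 * a)⁻¹) = 1 := by field_simp; norm_num
        rw [h4, mul_pow, mul_pow, pow_succ (4 : ℝ), pow_succ (2 * a)⁻¹]
        linear_combination (-(4 ^ m * ((m + 1 : ℕ) : ℝ) ^ (-(3 : ℝ) / 2) *
          ((f / a) ^ (m + 1) * (2 * a)⁻¹ ^ m))) * h5
    _ ≤ _ := mul_le_of_le_one_left (by positivity) (by linarith)

/-- For `‖B‖_∞ < 1` the triangular system has a unique bounded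
Borel solution on `[0,T]`, and there is an absolute constant `C` such that
`‖K_n‖_∞ ≤ C n^{-3/2} (2‖F‖_∞/(1−‖B‖_∞)²)ⁿ` for all `n ≥ 1`. -/
theorem stmt_11 :
    ∃ C : ℝ, 0 < C ∧
      ∀ (T : ℝ), 0 ≤ T →
      ∀ (ρ : Measure ℝ), IsProbabilityMeasure ρ → ρ {0} = 0 → ρ (Set.Iio 0) = 0 →
      ∀ (B F : ℝ → ℝ), Measurable B → Measurable F →
        (∃ M : ℝ, ∀ t ∈ Set.Icc 0 T, |B t| ≤ M) →
        (∃ M : ℝ, ∀ t ∈ Set.Icc 0 T, |F t| ≤ M) →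
        supNorm B T < 1 →
        (∃ K : ℕ → ℝ → ℝ, SolvesSystem T ρ B F K ∧
          (∀ K' : ℕ → ℝ → ℝ, SolvesSystem T ρ B F K' →
            ∀ n, ∀ t ∈ Set.Icc 0 T, K' n t = K n t)) ∧
        (∀ K : ℕ → ℝ → ℝ, SolvesSystem T ρ B F K →
          ∀ n : ℕ, 1 ≤ n →
            supNorm (K n) T ≤
              C * (n : ℝ) ^ (-(3 : ℝ) / 2) *
                (2 * supNorm F T / (1 - supNorm B T) ^ 2) ^ n) := by
  refine ⟨1, one_pos, fun T hT ρ hρ _ _ B F hBm hFm hB hF hb => ⟨?_, fun K hK n hn => ?_⟩⟩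
  · obtain ⟨K, hK⟩ := exists_solvesSystem ρ hBm hFm hB hF hb
    exact ⟨K, hK, fun K' hK' n => hK.unique hT hB hb hK' n⟩
  · obtain ⟨m, rfl⟩ := Nat.exists_eq_add_of_le' hn
    rw [one_mul]
    exact hK.supNorm_succ_le hT hF hb m
end
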